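/- Let S be a (2,ω)-divisible Cu-semigroup satisfying (O5), (O6) and (O7), let t ∈ S be strongly soft, and let t',x',x ∈ S be such that x' ≪ x ≤ ∞t and t' ≪ t. Then there exists a strongly soft element v' ∈ L_x such that x'+t' ≤ v'+t. -/

import Mathlib

open Set

/-- The way-below relation: `x ≪ y` if for every increasing sequence with a
supremum dominating `y`, some term of the sequence dominates `x`. -/
def WayBelow {S : Type*} [Preorder S] (x y : S) : Prop :=
  ∀ z : ℕ → S, Monotone z → ∀ s : S, IsLUB (Set.range z) s → y ≤ s → ∃ m : ℕ, x ≤ z m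

/-- A Cu-semigroup: a positively ordered commutative monoid satisfying (O1)-(O4). -/
class CuSemigroup (S : Type*) extends AddCommMonoid S, PartialOrder S where
  zero_le : ∀ x : S, 0 ≤ x
  add_mono : ∀ {a b c d : S}, a ≤ b → c ≤ d → a + c ≤ b + d
  O1 : ∀ z : ℕ → S, Monotone z → ∃ s : S, IsLUB (Set.range z) s
  O2 : ∀ x : S, ∃ z : ℕ → S, (∀ n, WayBelow (z n) (z (n + 1))) ∧ IsLUB (Set.range z) x
  O3 : ∀ {x' x y' y : S}, WayBelow x' x → WayBelow y' y → WayBelow (x' + y') (x + y)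
  O4 : ∀ (x y : ℕ → S), Monotone x → Monotone y → ∀ sx sy : S,
      IsLUB (Set.range x) sx → IsLUB (Set.range y) sy →
      IsLUB (Set.range fun n => x n + y n) (sx + sy)

variable {S : Type*}

lemma CuSemigroup.nsmul_mono [CuSemigroup S] (x : S) : Monotone fun n : ℕ => n • x := by
  intro n m h
  obtain ⟨k, rfl⟩ := Nat.exists_eq_add_of_le h
  show n • x ≤ (n + k) • x
  rw [add_nsmul]
  calc n • x = n • x + 0 := by rw [add_zero]
    _ ≤ n • x + k • x := CuSemigroup.add_mono le_rfl (CuSemigroup.zero_le _)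

/-- `infty x` is the supremum of the increasing sequence `n • x`, i.e. `∞x`. -/
noncomputable def infty [CuSemigroup S] (x : S) : S :=
  (CuSemigroup.O1 (fun n : ℕ => n • x) (CuSemigroup.nsmul_mono x)).choose

lemma infty_isLUB [CuSemigroup S] (x : S) :
    IsLUB (Set.range fun n : ℕ => n • x) (infty x) :=
  (CuSemigroup.O1 (fun n : ℕ => n • x) (CuSemigroup.nsmul_mono x)).choose_spec

/-- An element is strongly soft if every `x' ≪ x` admits `t` with `x' + t ≪ x`
and `x' ≪ ∞t`. -/
def StronglySoft [CuSemigroup S] (x : S) : Prop :=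
  ∀ x' : S, WayBelow x' x → ∃ t : S, WayBelow (x' + t) x ∧ WayBelow x' (infty t)

def SatisfiesO5 (S : Type*) [CuSemigroup S] : Prop :=
  ∀ x' x y' y z : S, WayBelow x' x → WayBelow y' y → x + y ≤ z →
    ∃ c : S, WayBelow y' c ∧ x' + c ≤ z ∧ z ≤ x + c

def SatisfiesO6 (S : Type*) [CuSemigroup S] : Prop :=
  ∀ x' x y z : S, WayBelow x' x → WayBelow x (y + z) →
    ∃ v w : S, v ≤ x ∧ v ≤ y ∧ w ≤ x ∧ w ≤ z ∧ x' ≤ v + w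

def SatisfiesO7 (S : Type*) [CuSemigroup S] : Prop :=
  ∀ x' x y' y w : S, WayBelow x' x → x ≤ w → WayBelow y' y → y ≤ w →
    ∃ z : S, WayBelow x' z ∧ WayBelow y' z ∧ z ≤ w ∧ z ≤ x + y

def TwoOmegaDivisible (S : Type*) [CuSemigroup S] : Prop :=
  ∀ x' x : S, WayBelow x' x → ∃ y : S, 2 • y ≤ x ∧ x' ≤ infty y

def WeaklyCancellative (S : Type*) [CuSemigroup S] : Prop :=
  ∀ x y z : S, WayBelow (x + z) (y + z) → WayBelow x y

def Separative (S : Type*) [CuSemigroup S] : Prop :=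
  ∀ x y t : S, WayBelow (x + t) (y + t) → WayBelow t (infty x) → WayBelow t (infty y) →
    WayBelow x y

def LeftSoftSeparative (S : Type*) [CuSemigroup S] : Prop :=
  ∀ x y t : S, StronglySoft x → WayBelow (x + t) (y + t) → WayBelow t (infty x) →
    WayBelow t (infty y) → WayBelow x y

def AlmostUnperforated (S : Type*) [CuSemigroup S] : Prop :=
  ∀ x y : S, (∃ n : ℕ, 1 ≤ n ∧ (n + 1) • x ≤ n • y) → x ≤ y

def CountablyBased (S : Type*) [CuSemigroup S] : Prop :=
  ∃ D : Set S, D.Countable ∧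
    ∀ x : S, ∃ z : ℕ → S, Monotone z ∧ (∀ n, z n ∈ D) ∧ IsLUB (Set.range z) x

/-- `Lset x` is the set `L_x = { u' : u' ≪ u ≪ x for some strongly soft u }`. -/
def Lset [CuSemigroup S] (x : S) : Set S :=
  { u' | ∃ u : S, StronglySoft u ∧ WayBelow u' u ∧ WayBelow u x }

/-- A functional on a Cu-semigroup: a monoid morphism to `[0,∞]` preserving order
and suprema of increasing sequences. -/
structure CuFunctional (S : Type*) [CuSemigroup S] where
  toFun : S → ENNReal
  map_zero : toFun 0 = 0
  map_add : ∀ x y : S, toFun (x + y) = toFun x + toFun y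
  mono : ∀ x y : S, x ≤ y → toFun x ≤ toFun y
  map_sup : ∀ z : ℕ → S, Monotone z → ∀ s : S, IsLUB (Set.range z) s →
    toFun s = ⨆ n, toFun (z n)

/-- Predicate version: `f : S → [0,∞]` is a functional on `S`. -/
def IsCuFunctional [CuSemigroup S] (f : S → ENNReal) : Prop :=
  f 0 = 0 ∧ (∀ x y : S, f (x + y) = f x + f y) ∧ (∀ x y : S, x ≤ y → f x ≤ f y) ∧
  (∀ z : ℕ → S, Monotone z → ∀ s : S, IsLUB (Set.range z) s → f s = ⨆ n, f (z n))

/-- Least upper bound of `A` computed within the subset `T`. -/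
def IsLUBIn [CuSemigroup S] (T : Set S) (A : Set S) (s : S) : Prop :=
  s ∈ T ∧ s ∈ upperBounds A ∧ ∀ b ∈ T, b ∈ upperBounds A → s ≤ b

/-- The way-below relation computed within the subset `T`. -/
def WayBelowIn [CuSemigroup S] (T : Set S) (x y : S) : Prop :=
  ∀ z : ℕ → S, Monotone z → (∀ n, z n ∈ T) → ∀ s : S, IsLUBIn T (Set.range z) s → y ≤ s →
    ∃ m : ℕ, x ≤ z m

/-- `T` is a sub-Cu-semigroup of `S`: a submonoid which is itself a Cu-semigroup
for the inherited order, such that the inclusion preserves suprema of increasing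
sequences and the way-below relation. -/
structure IsSubCuSemigroup [CuSemigroup S] (T : Set S) : Prop where
  zero_mem : (0 : S) ∈ T
  add_mem : ∀ {x y : S}, x ∈ T → y ∈ T → x + y ∈ T
  o1 : ∀ z : ℕ → S, Monotone z → (∀ n, z n ∈ T) → ∃ s : S, IsLUBIn T (Set.range z) s
  o2 : ∀ x ∈ T, ∃ z : ℕ → S, (∀ n, z n ∈ T) ∧ (∀ n, WayBelowIn T (z n) (z (n + 1))) ∧
        IsLUBIn T (Set.range z) x
  o3 : ∀ {x' x y' y : S}, x' ∈ T → x ∈ T → y' ∈ T → y ∈ T →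
        WayBelowIn T x' x → WayBelowIn T y' y → WayBelowIn T (x' + y') (x + y)
  o4 : ∀ (x y : ℕ → S), Monotone x → Monotone y → (∀ n, x n ∈ T) → (∀ n, y n ∈ T) →
        ∀ sx sy : S, IsLUBIn T (Set.range x) sx → IsLUBIn T (Set.range y) sy →
        IsLUBIn T (Set.range fun n => x n + y n) (sx + sy)
  incl_sup : ∀ z : ℕ → S, Monotone z → (∀ n, z n ∈ T) → ∀ s : S,
        IsLUBIn T (Set.range z) s → IsLUB (Set.range z) s
  incl_wayBelow : ∀ {x y : S}, x ∈ T → y ∈ T → WayBelowIn T x y → WayBelow x y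

def SatisfiesO5In [CuSemigroup S] (T : Set S) : Prop :=
  ∀ x' x y' y z : S, x' ∈ T → x ∈ T → y' ∈ T → y ∈ T → z ∈ T →
    WayBelowIn T x' x → WayBelowIn T y' y → x + y ≤ z →
    ∃ c ∈ T, WayBelowIn T y' c ∧ x' + c ≤ z ∧ z ≤ x + c

def SatisfiesO6In [CuSemigroup S] (T : Set S) : Prop :=
  ∀ x' x y z : S, x' ∈ T → x ∈ T → y ∈ T → z ∈ T →
    WayBelowIn T x' x → WayBelowIn T x (y + z) →
    ∃ v ∈ T, ∃ w ∈ T, v ≤ x ∧ v ≤ y ∧ w ≤ x ∧ w ≤ z ∧ x' ≤ v + w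

def SatisfiesO7In [CuSemigroup S] (T : Set S) : Prop :=
  ∀ x' x y' y w : S, x' ∈ T → x ∈ T → y' ∈ T → y ∈ T → w ∈ T →
    WayBelowIn T x' x → x ≤ w → WayBelowIn T y' y → y ≤ w →
    ∃ z ∈ T, WayBelowIn T x' z ∧ WayBelowIn T y' z ∧ z ≤ w ∧ z ≤ x + y

/-- `f` is a functional on the sub-Cu-semigroup `T` (values off `T` are irrelevant). -/
def IsFunctionalOn [CuSemigroup S] (T : Set S) (f : S → ENNReal) : Prop :=
  f 0 = 0 ∧
  (∀ x ∈ T, ∀ y ∈ T, f (x + y) = f x + f y) ∧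
  (∀ x ∈ T, ∀ y ∈ T, x ≤ y → f x ≤ f y) ∧
  (∀ z : ℕ → S, Monotone z → (∀ n, z n ∈ T) → ∀ s : S, IsLUBIn T (Set.range z) s →
    f s = ⨆ n, f (z n))

/-- An element is full if `x ≤ ∞e` for every `x`. -/
def IsFull [CuSemigroup S] (e : S) : Prop := ∀ x : S, x ≤ infty e

/-- Condition (R1) for `r`: comparison of `x` with `y` whenever
`λ(x) + r·λ(e) ≤ λ(y)` for all functionals. -/
def SatisfiesR1 (S : Type*) [CuSemigroup S] (e : S) (r : NNReal) : Prop :=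
  ∀ x y : S,
    (∀ lam : CuFunctional S, lam.toFun x + (r : ENNReal) * lam.toFun e ≤ lam.toFun y) → x ≤ y

/-- The radius of comparison of `(S, e)`. -/
noncomputable def rc (S : Type*) [CuSemigroup S] (e : S) : ENNReal :=
  ⨅ r ∈ {r : NNReal | 0 < r ∧ SatisfiesR1 S e r}, (r : ENNReal)

/-- Condition (R1) for the sub-Cu-semigroup `T`. -/
def SatisfiesR1On [CuSemigroup S] (T : Set S) (e : S) (r : NNReal) : Prop :=
  ∀ x ∈ T, ∀ y ∈ T,
    (∀ f : S → ENNReal, IsFunctionalOn T f → f x + (r : ENNReal) * f e ≤ f y) → x ≤ y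

/-- The radius of comparison of `(T, e)` for a sub-Cu-semigroup `T ⊆ S`. -/
noncomputable def rcOn [CuSemigroup S] (T : Set S) (e : S) : ENNReal :=
  ⨅ r ∈ {r : NNReal | 0 < r ∧ SatisfiesR1On T e r}, (r : ENNReal)

/-- `dim S ≤ n` in the sense of covering dimension of Cu-semigroups. -/
def DimLe (S : Type*) [CuSemigroup S] (n : ℕ) : Prop :=
  ∀ (x' x : S) (r : ℕ) (y : Fin r → S), WayBelow x' x → WayBelow x (∑ j, y j) →
    ∃ z : Fin r → Fin (n + 1) → S,
      (∀ j k, WayBelow (z j k) (y j)) ∧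
      WayBelow x' (∑ j, ∑ k, z j k) ∧
      (∀ k, WayBelow (∑ j, z j k) x)

/-- The covering dimension of a Cu-semigroup, in `ℕ ∪ {∞}`. -/
noncomputable def cuDim (S : Type*) [CuSemigroup S] : ℕ∞ :=
  ⨅ n ∈ {n : ℕ | DimLe S n}, (n : ℕ∞)

/-- `dim T ≤ n` for a sub-Cu-semigroup `T ⊆ S`. -/
def DimLeOn [CuSemigroup S] (T : Set S) (n : ℕ) : Prop :=
  ∀ (x' x : S), x' ∈ T → x ∈ T → ∀ (r : ℕ) (y : Fin r → S), (∀ j, y j ∈ T) →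
    WayBelowIn T x' x → WayBelowIn T x (∑ j, y j) →
    ∃ z : Fin r → Fin (n + 1) → S,
      (∀ j k, z j k ∈ T) ∧
      (∀ j k, WayBelowIn T (z j k) (y j)) ∧
      WayBelowIn T x' (∑ j, ∑ k, z j k) ∧
      (∀ k, WayBelowIn T (∑ j, z j k) x)

/-- The covering dimension of a sub-Cu-semigroup `T ⊆ S`. -/
noncomputable def cuDimOn [CuSemigroup S] (T : Set S) : ℕ∞ :=
  ⨅ n ∈ {n : ℕ | DimLeOn T n}, (n : ℕ∞)

section WayBelowLemmas

lemma WayBelow.le [Preorder S] {x y : S} (h : WayBelow x y) : x ≤ y := by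
  obtain ⟨_, hm⟩ := h (fun _ => y) monotone_const y (by simp) le_rfl
  exact hm

lemma WayBelow.trans_le [Preorder S] {x y z : S} (h : WayBelow x y) (hyz : y ≤ z) :
    WayBelow x z :=
  fun w hw s hs hzs => h w hw s hs (hyz.trans hzs)

lemma LE.le.trans_wayBelow [Preorder S] {x y z : S} (hxy : x ≤ y) (h : WayBelow y z) :
    WayBelow x z := fun w hw s hs hzs =>
  let ⟨m, hm⟩ := h w hw s hs hzs
  ⟨m, hxy.trans hm⟩

end WayBelowLemmas

namespace CuSemigroup

variable [CuSemigroup S]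

instance : IsOrderedAddMonoid S where
  add_le_add_left _ _ h _ := add_mono h le_rfl

lemma le_add_right' (x y : S) : x ≤ x + y := by
  simpa using add_mono (le_refl x) (zero_le y)

lemma le_add_left' (x y : S) : x ≤ y + x := by
  simpa using add_mono (zero_le y) (le_refl x)

lemma zero_wayBelow (x : S) : WayBelow 0 x := fun _ _ _ _ _ => ⟨0, zero_le _⟩

lemma exists_wayBelow_seq (x : S) :
    ∃ z : ℕ → S, Monotone z ∧ (∀ n, WayBelow (z n) x) ∧ IsLUB (range z) x := by
  obtain ⟨z, hz, hx⟩ := O2 x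
  exact ⟨z, monotone_nat_of_le_succ fun n => (hz n).le,
    fun n => (hz n).trans_le (hx.1 (mem_range_self _)), hx⟩

lemma exists_between {x z : S} (h : WayBelow x z) : ∃ y, WayBelow x y ∧ WayBelow y z := by
  obtain ⟨w, hw, hz⟩ := O2 z
  obtain ⟨n, hn⟩ := h w (monotone_nat_of_le_succ fun n => (hw n).le) z hz le_rfl
  exact ⟨w (n + 1), hn.trans_wayBelow (hw n), (hw (n + 1)).trans_le (hz.1 (mem_range_self _))⟩

lemma exists_wayBelow_upper_bound {a b x : S} (ha : WayBelow a x) (hb : WayBelow b x) :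
    ∃ c, a ≤ c ∧ b ≤ c ∧ WayBelow c x := by
  obtain ⟨z, hz, hzx, hx⟩ := exists_wayBelow_seq x
  obtain ⟨m, hm⟩ := ha z hz x hx le_rfl
  obtain ⟨n, hn⟩ := hb z hz x hx le_rfl
  exact ⟨z (max m n), hm.trans (hz (le_max_left m n)), hn.trans (hz (le_max_right m n)), hzx _⟩

lemma exists_le_add_of_wayBelow_add {p x y : S} (h : WayBelow p (x + y)) :
    ∃ x' y', WayBelow x' x ∧ WayBelow y' y ∧ p ≤ x' + y' := by
  obtain ⟨u, hu, hux, hx⟩ := exists_wayBelow_seq x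
  obtain ⟨v, hv, hvy, hy⟩ := exists_wayBelow_seq y
  obtain ⟨m, hm⟩ := h _ (fun i j hij => add_mono (hu hij) (hv hij)) _
    (O4 u v hu hv x y hx hy) le_rfl
  exact ⟨u m, v m, hux m, hvy m, hm⟩

lemma nsmul_le_infty (n : ℕ) (x : S) : n • x ≤ infty x :=
  (infty_isLUB x).1 ⟨n, rfl⟩

lemma le_infty (x : S) : x ≤ infty x := by simpa using nsmul_le_infty 1 x

lemma infty_add_infty (x : S) : infty x + infty x = infty x := by
  have h := O4 _ _ (nsmul_mono x) (nsmul_mono x) _ _ (infty_isLUB x) (infty_isLUB x)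
  apply le_antisymm
  · refine h.2 ?_
    rintro _ ⟨n, rfl⟩
    change n • x + n • x ≤ _
    rw [← add_nsmul]
    exact nsmul_le_infty _ x
  · exact le_add_right' _ _

lemma add_le_infty {x y z : S} (hx : x ≤ infty z) (hy : y ≤ infty z) : x + y ≤ infty z :=
  (add_mono hx hy).trans (infty_add_infty z).le

lemma infty_le_infty {x y : S} (h : x ≤ infty y) : infty x ≤ infty y := by
  refine (infty_isLUB x).2 ?_
  rintro _ ⟨n, rfl⟩
  change n • x ≤ _
  induction n with
  | zero => simpa using zero_le (infty y)
  | succ n ih => rw [succ_nsmul]; exact add_le_infty ih h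

lemma infty_mono {x y : S} (h : x ≤ y) : infty x ≤ infty y :=
  infty_le_infty (h.trans (le_infty y))

lemma exists_wayBelow_nsmul {p y : S} {n : ℕ} (h : WayBelow p (n • y)) :
    ∃ t, WayBelow t y ∧ p ≤ n • t := by
  induction n generalizing p with
  | zero => exact ⟨0, zero_wayBelow y, by simpa using h.le⟩
  | succ n ih =>
    rw [succ_nsmul] at h
    obtain ⟨a, b, ha, hb, hp⟩ := exists_le_add_of_wayBelow_add h
    obtain ⟨s, hs, has⟩ := ih ha
    obtain ⟨t, hst, hbt, ht⟩ := exists_wayBelow_upper_bound hs hb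
    refine ⟨t, ht, hp.trans ?_⟩
    rw [succ_nsmul]
    exact add_mono (has.trans (nsmul_le_nsmul_right hst n)) hbt

lemma exists_wayBelow_infty {p y : S} (h : WayBelow p (infty y)) :
    ∃ t, WayBelow t y ∧ WayBelow p (infty t) := by
  obtain ⟨q, hpq, hq⟩ := exists_between h
  obtain ⟨r, hqr, hr⟩ := exists_between hq
  obtain ⟨n, hn⟩ := hr _ (nsmul_mono y) _ (infty_isLUB y) le_rfl
  obtain ⟨t, hty, hqt⟩ := exists_wayBelow_nsmul (hqr.trans_le hn)
  exact ⟨t, hty, hpq.trans_le (hqt.trans (nsmul_le_infty n t))⟩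

end CuSemigroup

open CuSemigroup

section Soft

variable [CuSemigroup S]

lemma StronglySoft.add_of_le_infty {r d : S} (hr : StronglySoft r) (hd : d ≤ infty r) :
    StronglySoft (d + r) := by
  intro x' hx'
  obtain ⟨x, hx'x, hx⟩ := exists_between hx'
  obtain ⟨d', r₁, hd', hr₁, hxle⟩ := exists_le_add_of_wayBelow_add hx
  obtain ⟨r₂, hr₂, hdr₂⟩ := exists_wayBelow_infty (hd'.trans_le hd)
  obtain ⟨r', h₁, h₂, hr'⟩ := exists_wayBelow_upper_bound hr₁ hr₂
  obtain ⟨t, hrt, hr't⟩ := hr r' hr'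
  refine ⟨t, ?_, hx'x.trans_le (hxle.trans (add_le_infty ?_ (h₁.trans hr't.le)))⟩
  · refine LE.le.trans_wayBelow ?_ (O3 hd' hrt)
    rw [← add_assoc]
    exact add_mono ((hx'x.le.trans hxle).trans (add_mono le_rfl h₁)) le_rfl
  · exact hdr₂.le.trans (infty_le_infty (h₂.trans hr't.le))

/-- The supremum of the partial sums of a sequence is strongly soft if each term
lies in the ideal generated by the next one. -/
lemma stronglySoft_of_isLUB_sum {y : ℕ → S} (hy : ∀ n, y n ≤ infty (y (n + 1))) {r : S}
    (hr : IsLUB (range fun n => ∑ i ∈ Finset.range n, y i) r) : StronglySoft r := by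
  have hmono : Monotone fun n => ∑ i ∈ Finset.range n, y i :=
    monotone_nat_of_le_succ fun n => by
      rw [Finset.sum_range_succ]
      exact le_add_right' _ _
  have hsum : ∀ n, ∑ i ∈ Finset.range n, y i ≤ infty (y n) := by
    intro n
    induction n with
    | zero => simpa using zero_le (infty (y 0))
    | succ n ih =>
      rw [Finset.sum_range_succ]
      exact add_le_infty (ih.trans (infty_le_infty (hy n))) (hy n)
  intro x' hx'
  obtain ⟨x, hx'x, hx⟩ := exists_between hx'
  obtain ⟨n, hn⟩ := hx _ hmono r hr le_rfl
  obtain ⟨t, ht, hx't⟩ := exists_wayBelow_infty (hx'x.trans_le (hn.trans (hsum n)))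
  refine ⟨t, (O3 hx'x ht).trans_le ?_, hx't⟩
  calc x + y n ≤ ∑ i ∈ Finset.range n, y i + y n := add_mono hn le_rfl
    _ = ∑ i ∈ Finset.range (n + 1), y i := (Finset.sum_range_succ _ _).symm
    _ ≤ r := hr.1 (mem_range_self (n + 1))

lemma TwoOmegaDivisible.exists_step (hdiv : TwoOmegaDivisible S) {y' y : S}
    (h : WayBelow y' y) : ∃ w' w : S, WayBelow w' w ∧ 2 • w ≤ y ∧ y' ≤ infty w' := by
  obtain ⟨y'', h₁, h₂⟩ := exists_between h
  obtain ⟨w, hw, hyw⟩ := hdiv y'' y h₂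
  obtain ⟨w', hw', hy'⟩ := exists_wayBelow_infty (h₁.trans_le hyw)
  exact ⟨w', w, hw', hw, hy'.le⟩

lemma TwoOmegaDivisible.exists_stronglySoft (hdiv : TwoOmegaDivisible S) {a' a : S}
    (h : WayBelow a' a) : ∃ r : S, StronglySoft r ∧ r ≤ a ∧ a' ≤ infty r := by
  have step : ∀ p : {p : S × S // WayBelow p.1 p.2}, ∃ q : {q : S × S // WayBelow q.1 q.2},
      2 • q.1.2 ≤ p.1.2 ∧ p.1.1 ≤ infty q.1.1 := by
    rintro ⟨⟨y', y⟩, hy⟩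
    obtain ⟨w', w, hw, h₁, h₂⟩ := hdiv.exists_step hy
    exact ⟨⟨⟨w', w⟩, hw⟩, h₁, h₂⟩
  choose f hf₁ hf₂ using step
  let g : ℕ → {p : S × S // WayBelow p.1 p.2} := fun n => f^[n] ⟨⟨a', a⟩, h⟩
  have hg : ∀ n, g (n + 1) = f (g n) := fun n => Function.iterate_succ_apply' f n _
  let y : ℕ → S := fun n => (g (n + 1)).1.1
  have hy : ∀ n, y n ≤ infty (y (n + 1)) := fun n => by
    change (g (n + 1)).1.1 ≤ infty (g (n + 1 + 1)).1.1
    rw [hg (n + 1)]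
    exact hf₂ _
  have hsum : ∀ n, ∑ i ∈ Finset.range n, y i + (g n).1.2 ≤ a := by
    intro n
    induction n with
    | zero => simp [g]
    | succ n ih =>
      refine le_trans ?_ ih
      rw [Finset.sum_range_succ, add_assoc]
      refine add_mono le_rfl (le_trans ?_ (hf₁ (g n)))
      rw [two_nsmul, ← hg n]
      exact add_mono (g (n + 1)).2.le le_rfl
  obtain ⟨r, hr⟩ := O1 (fun n => ∑ i ∈ Finset.range n, y i)
    (monotone_nat_of_le_succ fun n => by
      rw [Finset.sum_range_succ]
      exact le_add_right' _ _)
  refine ⟨r, stronglySoft_of_isLUB_sum hy hr, hr.2 ?_, ?_⟩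
  · rintro _ ⟨n, rfl⟩
    exact (le_add_right' _ _).trans (hsum n)
  · have h₀ : y 0 ≤ r := by
      have := hr.1 (mem_range_self 1)
      simpa using this
    exact (hf₂ (g 0)).trans (infty_mono (by rw [← hg 0]; exact h₀))

lemma TwoOmegaDivisible.exists_nsmul_le (hdiv : TwoOmegaDivisible S) (n : ℕ) {x' x : S}
    (h : WayBelow x' x) : ∃ y : S, n • y ≤ x ∧ x' ≤ infty y := by
  have key : ∀ k : ℕ, ∃ y' y : S, WayBelow y' y ∧ 2 ^ k • y ≤ x ∧ x' ≤ infty y' := by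
    intro k
    induction k with
    | zero => exact ⟨x', x, h, by simp, le_infty x'⟩
    | succ k ih =>
      obtain ⟨y', y, hy, hyx, hx'⟩ := ih
      obtain ⟨w', w, hw, hwy, hy'⟩ := hdiv.exists_step hy
      refine ⟨w', w, hw, ?_, hx'.trans (infty_le_infty hy')⟩
      rw [pow_succ, mul_nsmul']
      exact (nsmul_le_nsmul_right hwy _).trans hyx
  obtain ⟨y', y, hy, hyx, hx'⟩ := key n
  exact ⟨y, (nsmul_mono y Nat.lt_two_pow_self.le).trans hyx, hx'.trans (infty_mono hy.le)⟩

lemma exists_le_and_le_nsmul (hO6 : SatisfiesO6 S) (hO7 : SatisfiesO7 S) (n : ℕ) {y' y s : S}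
    (hy : WayBelow y' y) (hys : y ≤ n • s) :
    ∃ c : S, c ≤ s ∧ c ≤ n • y ∧ y' ≤ infty c := by
  induction n generalizing y' y with
  | zero =>
    refine ⟨0, zero_le s, by simp, ?_⟩
    rw [zero_nsmul] at hys
    exact (hy.le.trans hys).trans (zero_le _)
  | succ n ih =>
    obtain ⟨y₁, hy'₁, hy₁⟩ := exists_between hy
    obtain ⟨y₂, hy₁₂, hy₂⟩ := exists_between hy₁
    rw [succ_nsmul] at hys
    obtain ⟨v, w, hvy, hvs, hwy, hws, hvw⟩ :=
      hO6 y₁ y₂ (n • s) s hy₁₂ (hy₂.trans_le hys)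
    obtain ⟨v', w', hv', hw', hyvw⟩ := exists_le_add_of_wayBelow_add (hy'₁.trans_le hvw)
    obtain ⟨v'', hv'v, hv''⟩ := exists_between hv'
    obtain ⟨c, hcs, hcv, hvc⟩ := ih hv'' hvs
    obtain ⟨c', hc', hvc'⟩ := exists_wayBelow_infty (hv'v.trans_le hvc)
    obtain ⟨z, hcz, hwz, hzs, hz⟩ := hO7 c' c w' w s hc' hcs hw' hws
    refine ⟨z, hzs, ?_, hyvw.trans (add_le_infty ?_ (hwz.le.trans (le_infty z)))⟩
    · rw [succ_nsmul]
      exact hz.trans (add_mono (hcv.trans (nsmul_le_nsmul_right (hvy.trans hy₂.le) n))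
        (hwy.trans hy₂.le))
    · exact hvc'.le.trans (infty_mono hcz.le)

/-- In a (2,ω)-divisible Cu-semigroup with (O6) and (O7), if `x' ≪ x ≤ ∞s`, then `x'` is in
the ideal generated by a common lower bound of `x` and `s`. -/
lemma TwoOmegaDivisible.exists_le_and_le (hdiv : TwoOmegaDivisible S) (hO6 : SatisfiesO6 S)
    (hO7 : SatisfiesO7 S) {x' x s : S} (hx : WayBelow x' x) (hxs : x ≤ infty s) :
    ∃ c : S, c ≤ x ∧ c ≤ s ∧ x' ≤ infty c := by
  obtain ⟨x₂, hx'₂, hx₂⟩ := exists_between hx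
  obtain ⟨x₁, hx'₁, hx₁⟩ := exists_between hx'₂
  obtain ⟨n, hn⟩ := hx₂ _ (nsmul_mono s) _ (infty_isLUB s) hxs
  obtain ⟨y, hyx, hxy⟩ := hdiv.exists_nsmul_le (n + 1) hx₁
  obtain ⟨y', hy', hxy'⟩ := exists_wayBelow_infty (hx'₁.trans_le hxy)
  have hyx' : y ≤ x₂ := by
    rw [succ_nsmul] at hyx
    exact (le_add_left' _ _).trans hyx
  obtain ⟨c, hcs, hcy, hyc⟩ := exists_le_and_le_nsmul hO6 hO7 n hy' (hyx'.trans hn)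
  exact ⟨c, hcy.trans (((nsmul_mono y n.le_succ).trans hyx).trans hx₂.le), hcs,
    hxy'.le.trans (infty_le_infty hyc)⟩

lemma TwoOmegaDivisible.exists_stronglySoft_le_add (hdiv : TwoOmegaDivisible S)
    (hO5 : SatisfiesO5 S) (hO6 : SatisfiesO6 S) (hO7 : SatisfiesO7 S) {x' x s : S}
    (hx : WayBelow x' x) (hxs : x ≤ infty s) :
    ∃ u : S, StronglySoft u ∧ u ≤ x ∧ x' ≤ u + s := by
  obtain ⟨x₁, hx'₁, hx₁⟩ := exists_between hx
  obtain ⟨x₂, hx₁₂, hx₂⟩ := exists_between hx₁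
  obtain ⟨c, hcx, hcs, hxc⟩ := hdiv.exists_le_and_le hO6 hO7 hx₂ hxs
  obtain ⟨c', hc', hxc'⟩ := exists_wayBelow_infty (hx₁₂.trans_le hxc)
  obtain ⟨c₀, hc₀, hxc₀⟩ := exists_wayBelow_infty hxc'
  obtain ⟨r, hr, hrc, hcr⟩ := hdiv.exists_stronglySoft hc₀
  obtain ⟨d, -, hd₁, hd₂⟩ := hO5 c' c 0 0 x hc' (zero_wayBelow 0) (by simpa using hcx)
  obtain ⟨v, f, -, hvc, hfx, hfd, hvf⟩ := hO6 x' x₁ c d hx'₁ (hx₁.trans_le hd₂)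
  refine ⟨f + r, hr.add_of_le_infty (hfx.trans (hxc₀.le.trans (infty_le_infty hcr))), ?_, ?_⟩
  · rw [add_comm]
    exact (add_mono hrc hfd).trans hd₁
  · rw [add_comm (f + r)]
    exact hvf.trans (add_mono (hvc.trans hcs) (le_add_right' f r))

/-- A strongly soft element is approximated from below by strongly soft elements. -/
lemma StronglySoft.exists_between (hdiv : TwoOmegaDivisible S) {u u' : S}
    (hu : StronglySoft u) (h : WayBelow u' u) :
    ∃ v : S, StronglySoft v ∧ u' ≤ v ∧ WayBelow v u := by
  obtain ⟨q, hq, huq⟩ := hu u' h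
  obtain ⟨q', hq', huq'⟩ := exists_wayBelow_infty huq
  obtain ⟨r, hr, hrq, hqr⟩ := hdiv.exists_stronglySoft hq'
  exact ⟨u' + r, hr.add_of_le_infty (huq'.le.trans (infty_le_infty hqr)), le_add_right' _ _,
    (add_mono le_rfl hrq).trans_wayBelow hq⟩

end Soft

/-- In a (2,ω)-divisible Cu-semigroup satisfying (O5)-(O7), if `t`
is strongly soft, `x' ≪ x ≤ ∞t` and `t' ≪ t`, then there is a strongly soft
`v' ∈ L_x` with `x' + t' ≤ v' + t`. -/
theorem improved_sigma_domination {S : Type*} [CuSemigroup S]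
    (hdiv : TwoOmegaDivisible S)
    (hO5 : SatisfiesO5 S) (hO6 : SatisfiesO6 S) (hO7 : SatisfiesO7 S)
    {t t' x' x : S} (ht : StronglySoft t)
    (h1 : WayBelow x' x) (h2 : x ≤ infty t) (h3 : WayBelow t' t) :
    ∃ v' : S, v' ∈ Lset x ∧ StronglySoft v' ∧ x' + t' ≤ v' + t := by
  obtain ⟨x₁, hx'₁, hx₁⟩ := exists_between h1
  obtain ⟨x₂, hx₁₂, hx₂⟩ := exists_between hx₁
  obtain ⟨t₁, ht₁, hxt₁⟩ := exists_wayBelow_infty (hx₂.trans_le h2)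
  obtain ⟨t₂, ht₁₂, ht'₂, ht₂⟩ := exists_wayBelow_upper_bound ht₁ h3
  obtain ⟨s, hts, ht₂s⟩ := ht t₂ ht₂
  obtain ⟨u, hu, hux, hxu⟩ := hdiv.exists_stronglySoft_le_add hO5 hO6 hO7 hx₁₂
    (hxt₁.le.trans (infty_le_infty (ht₁₂.trans ht₂s.le)))
  obtain ⟨u', s', hu', hs', hxus⟩ := exists_le_add_of_wayBelow_add (hx'₁.trans_le hxu)
  obtain ⟨v, hv, huv, hvu⟩ := hu.exists_between hdiv hu'
  refine ⟨v, ⟨u, hu, hvu, hux.trans_wayBelow hx₂⟩, hv, ?_⟩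
  calc x' + t' ≤ (u' + s') + t₂ := add_mono hxus ht'₂
    _ ≤ (v + s) + t₂ := add_mono (add_mono huv hs'.le) le_rfl
    _ = v + (t₂ + s) := by rw [add_assoc, add_comm s]
    _ ≤ v + t := add_mono le_rfl hts.le
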